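/- Let M and L be abelian groups. Let B(M, L) := (F ⊕ Q)/T, where F is the free abelian group on generators {P_{(m,l)} : (m,l) ∈ M × L}, Q is the quotient of (M ⊗_ℤ L) ⊗_ℤ (M ⊗_ℤ L) by the subgroup generated by all u ⊗ v − v ⊗ u (images written [u ⊗ v]), and T is the subgroup generated by all elements P_{(a+b,l)} − P_{(a,l)} − P_{(b,l)} − [(a ⊗ l) ⊗ (b ⊗ l)] for a, b ∈ M, l ∈ L, and all elements P_{(m,y+z)} − P_{(m,y)} − P_{(m,z)} − [(m ⊗ y) ⊗ (m ⊗ z)] for m ∈ M, y, z ∈ L. Then there is a unique group homomorphism B(M, L) → A(M ⊗_ℤ L) sending [P_{(m,l)}] to [N_{m ⊗ l}] and [u ⊗ v] to [u ⊗ v], and this homomorphism is an isomorphism. -/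

import Mathlib

open scoped TensorProduct

/-- The subgroup of `M ⊗_ℤ M` generated by the elements `x ⊗ y - y ⊗ x`. -/
noncomputable def symSub (M : Type*) [AddCommGroup M] : AddSubgroup (TensorProduct ℤ M M) :=
  AddSubgroup.closure {z | ∃ x y : M, z = x ⊗ₜ[ℤ] y - y ⊗ₜ[ℤ] x}

/-- `Q_M`: the quotient of `M ⊗_ℤ M` by the subgroup generated by `x ⊗ y - y ⊗ x`. -/
abbrev QGrp (M : Type*) [AddCommGroup M] :=
  TensorProduct ℤ M M ⧸ symSub M

/-- The Tambara reciprocity subgroup `T_M ≤ F_M ⊕ Q_M`, generated by the elements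
`N_{a+b} - N_a - N_b - [a ⊗ b]`. -/
noncomputable def trSub (M : Type*) [AddCommGroup M] :
    AddSubgroup (FreeAbelianGroup M × QGrp M) :=
  AddSubgroup.closure {z | ∃ a b : M,
    z = (FreeAbelianGroup.of (a + b) - FreeAbelianGroup.of a - FreeAbelianGroup.of b,
          -(QuotientAddGroup.mk (a ⊗ₜ[ℤ] b)))}

/-- `A(M) = (F_M ⊕ Q_M) / T_M`, the top level of the norm construction `N^{C₂}_e M`. -/
abbrev AGrp (M : Type*) [AddCommGroup M] :=
  (FreeAbelianGroup M × QGrp M) ⧸ trSub M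

/-- The class `[N_a]` in `A(M)`. -/
noncomputable def Ncl {M : Type*} [AddCommGroup M] (a : M) : AGrp M :=
  QuotientAddGroup.mk (FreeAbelianGroup.of a, 0)

/-- The class `[x ⊗ y]` in `A(M)`. -/
noncomputable def Tcl {M : Type*} [AddCommGroup M] (x y : M) : AGrp M :=
  QuotientAddGroup.mk (0, QuotientAddGroup.mk (x ⊗ₜ[ℤ] y))

/-- The subgroup `T ≤ ℤ{M × L} ⊕ Q_{M ⊗ L}` generated by the elements
`P_{(a+b,l)} - P_{(a,l)} - P_{(b,l)} - [(a ⊗ l) ⊗ (b ⊗ l)]` and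
`P_{(m,y+z)} - P_{(m,y)} - P_{(m,z)} - [(m ⊗ y) ⊗ (m ⊗ z)]`. -/
noncomputable def bSub (M L : Type*) [AddCommGroup M] [AddCommGroup L] :
    AddSubgroup (FreeAbelianGroup (M × L) × QGrp (TensorProduct ℤ M L)) :=
  AddSubgroup.closure
    ({z | ∃ (a b : M) (l : L),
        z = (FreeAbelianGroup.of (a + b, l) - FreeAbelianGroup.of (a, l)
              - FreeAbelianGroup.of (b, l),
             -(QuotientAddGroup.mk ((a ⊗ₜ[ℤ] l) ⊗ₜ[ℤ] (b ⊗ₜ[ℤ] l))))} ∪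
     {z | ∃ (m : M) (y z' : L),
        z = (FreeAbelianGroup.of (m, y + z') - FreeAbelianGroup.of (m, y)
              - FreeAbelianGroup.of (m, z'),
             -(QuotientAddGroup.mk ((m ⊗ₜ[ℤ] y) ⊗ₜ[ℤ] (m ⊗ₜ[ℤ] z'))))})

/-- `B(M, L) = (F ⊕ Q) / T`, the top level of `N^{C₂}_e M □ N^{C₂}_e L`. -/
abbrev BGrp (M L : Type*) [AddCommGroup M] [AddCommGroup L] :=
  (FreeAbelianGroup (M × L) × QGrp (TensorProduct ℤ M L)) ⧸ bSub M L

/-- The class `[P_{(m,l)}]` in `B(M, L)`. -/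
noncomputable def Pcl {M L : Type*} [AddCommGroup M] [AddCommGroup L] (m : M) (l : L) :
    BGrp M L :=
  QuotientAddGroup.mk (FreeAbelianGroup.of (m, l), 0)

/-- The class `[u ⊗ v]` in `B(M, L)`, for `u v : M ⊗_ℤ L`. -/
noncomputable def BTcl {M L : Type*} [AddCommGroup M] [AddCommGroup L]
    (u v : TensorProduct ℤ M L) : BGrp M L :=
  QuotientAddGroup.mk (0, QuotientAddGroup.mk (u ⊗ₜ[ℤ] v))

section Helpers

variable {M L : Type*} [AddCommGroup M] [AddCommGroup L]

/-- The bilinear classes of `B` as an additive map. -/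
noncomputable def bT (M L : Type*) [AddCommGroup M] [AddCommGroup L] :
    QGrp (TensorProduct ℤ M L) →+ BGrp M L :=
  (QuotientAddGroup.mk' (bSub M L)).comp (AddMonoidHom.inr _ _)

theorem BTcl_add_left (u v w : TensorProduct ℤ M L) :
    BTcl (u + v) w = BTcl u w + BTcl v w := by
  have h : ∀ x y : TensorProduct ℤ M L,
    BTcl x y = bT M L (QuotientAddGroup.mk' _ (x ⊗ₜ[ℤ] y)) := fun _ _ => rfl
  simp only [h, TensorProduct.add_tmul, map_add]

theorem BTcl_add_right (u v w : TensorProduct ℤ M L) :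
    BTcl u (v + w) = BTcl u v + BTcl u w := by
  have h : ∀ x y : TensorProduct ℤ M L,
    BTcl x y = bT M L (QuotientAddGroup.mk' _ (x ⊗ₜ[ℤ] y)) := fun _ _ => rfl
  simp only [h, TensorProduct.tmul_add, map_add]

theorem Q_comm {M : Type*} [AddCommGroup M] (x y : M) :
    (QuotientAddGroup.mk (x ⊗ₜ[ℤ] y) : QGrp M) = QuotientAddGroup.mk (y ⊗ₜ[ℤ] x) := by
  rw [QuotientAddGroup.eq]
  apply AddSubgroup.subset_closure
  exact ⟨y, x, by abel⟩

theorem BTcl_comm (u v : TensorProduct ℤ M L) : BTcl u v = BTcl v u := by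
  unfold BTcl
  rw [Q_comm]

theorem BTcl_zero_left (v : TensorProduct ℤ M L) : BTcl 0 v = 0 := by
  have := BTcl_add_left (0 : TensorProduct ℤ M L) 0 v
  rw [add_zero] at this
  exact left_eq_add.mp this

theorem BTcl_zero_right (v : TensorProduct ℤ M L) : BTcl v 0 = 0 := by
  rw [BTcl_comm, BTcl_zero_left]

theorem Pcl_add_left (a b : M) (l : L) :
    Pcl (a + b) l = Pcl a l + Pcl b l + BTcl (a ⊗ₜ[ℤ] l) (b ⊗ₜ[ℤ] l) := by
  rw [eq_comm]
  refine (QuotientAddGroup.eq (s := bSub M L)).mpr ?_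
  apply AddSubgroup.subset_closure
  refine Or.inl ⟨a, b, l, ?_⟩
  ext
  · simp; abel
  · simp

theorem Pcl_add_right (m : M) (y z : L) :
    Pcl m (y + z) = Pcl m y + Pcl m z + BTcl (m ⊗ₜ[ℤ] y) (m ⊗ₜ[ℤ] z) := by
  rw [eq_comm]
  refine (QuotientAddGroup.eq (s := bSub M L)).mpr ?_
  apply AddSubgroup.subset_closure
  refine Or.inr ⟨m, y, z, ?_⟩
  ext
  · simp; abel
  · simp

theorem Ncl_add {M : Type*} [AddCommGroup M] (a b : M) :
    Ncl (a + b) = Ncl a + Ncl b + Tcl a b := by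
  rw [eq_comm]
  refine (QuotientAddGroup.eq (s := trSub M)).mpr ?_
  apply AddSubgroup.subset_closure
  refine ⟨a, b, ?_⟩
  ext
  · simp; abel
  · simp

theorem Tcl_zero {M : Type*} [AddCommGroup M] : Tcl (0 : M) 0 = 0 := by
  unfold Tcl
  rw [TensorProduct.zero_tmul]
  rfl

theorem Ncl_zero {M : Type*} [AddCommGroup M] : Ncl (0 : M) = 0 := by
  have := Ncl_add (0 : M) 0
  rw [Tcl_zero, add_zero, add_zero] at this
  exact left_eq_add.mp this

/-- The extension of `M ⊗ L` by `B(M, L)` with cocycle `[u ⊗ v]`. -/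
@[ext] structure Ext2 (M L : Type*) [AddCommGroup M] [AddCommGroup L] where
  b : BGrp M L
  u : TensorProduct ℤ M L

noncomputable instance : Add (Ext2 M L) := ⟨fun x y => ⟨x.b + y.b + BTcl x.u y.u, x.u + y.u⟩⟩
noncomputable instance : Zero (Ext2 M L) := ⟨⟨0, 0⟩⟩
noncomputable instance : Neg (Ext2 M L) := ⟨fun x => ⟨-x.b + BTcl x.u x.u, -x.u⟩⟩

theorem Ext2.add_b (x y : Ext2 M L) : (x + y).b = x.b + y.b + BTcl x.u y.u := rfl
theorem Ext2.add_u (x y : Ext2 M L) : (x + y).u = x.u + y.u := rfl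
theorem Ext2.zero_b : (0 : Ext2 M L).b = 0 := rfl
theorem Ext2.zero_u : (0 : Ext2 M L).u = 0 := rfl
theorem Ext2.neg_b (x : Ext2 M L) : (-x).b = -x.b + BTcl x.u x.u := rfl
theorem Ext2.neg_u (x : Ext2 M L) : (-x).u = -x.u := rfl

noncomputable instance : AddCommGroup (Ext2 M L) where
  add_assoc x y z := by
    ext
    · simp only [Ext2.add_b, Ext2.add_u, BTcl_add_left, BTcl_add_right]; abel
    · simp only [Ext2.add_u]; abel
  zero_add x := by
    ext
    · simp only [Ext2.add_b, Ext2.zero_b, Ext2.zero_u, BTcl_zero_left]; abel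
    · simp only [Ext2.add_u, Ext2.zero_u]; abel
  add_zero x := by
    ext
    · simp only [Ext2.add_b, Ext2.zero_b, Ext2.zero_u, BTcl_zero_right]; abel
    · simp only [Ext2.add_u, Ext2.zero_u]; abel
  nsmul := nsmulRec
  zsmul := zsmulRec
  neg_add_cancel x := by
    ext
    · simp only [Ext2.add_b, Ext2.neg_b, Ext2.neg_u, Ext2.zero_b]
      have h := BTcl_add_left (-x.u) x.u x.u
      rw [neg_add_cancel, BTcl_zero_left] at h
      rw [h]; abel
    · simp only [Ext2.add_u, Ext2.neg_u, Ext2.zero_u]; abel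
  add_comm x y := by
    ext
    · simp only [Ext2.add_b, BTcl_comm x.u y.u]; abel
    · simp only [Ext2.add_u]; abel

/-- The biadditive map `(m, l) ↦ (P_{(m,l)}, m ⊗ l)`. -/
noncomputable def secBi (M L : Type*) [AddCommGroup M] [AddCommGroup L] : M →+ L →+ Ext2 M L :=
  AddMonoidHom.mk' (fun m => AddMonoidHom.mk' (fun l => ⟨Pcl m l, m ⊗ₜ[ℤ] l⟩) (by
    intro y z
    ext
    · exact Pcl_add_right m y z
    · exact TensorProduct.tmul_add m y z)) (by
    intro a b
    ext l
    · exact Pcl_add_left a b l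
    · exact TensorProduct.add_tmul a b l)

/-- The section `M ⊗ L → Ext2 M L`. -/
noncomputable def sec (M L : Type*) [AddCommGroup M] [AddCommGroup L] :
    TensorProduct ℤ M L →+ Ext2 M L :=
  TensorProduct.liftAddHom (secBi M L) (by
    intro r m l
    rw [map_zsmul, map_zsmul]; rfl)

theorem sec_tmul (m : M) (l : L) : sec M L (m ⊗ₜ[ℤ] l) = ⟨Pcl m l, m ⊗ₜ[ℤ] l⟩ := by
  unfold sec
  rw [TensorProduct.liftAddHom_tmul]; rfl

theorem sec_u (x : TensorProduct ℤ M L) : (sec M L x).u = x := by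
  induction x using TensorProduct.induction_on with
  | zero => rw [map_zero]; rfl
  | tmul m l => rw [sec_tmul]
  | add x y hx hy => rw [map_add, Ext2.add_u, hx, hy]

theorem sec_b_add (x y : TensorProduct ℤ M L) :
    (sec M L (x + y)).b = (sec M L x).b + (sec M L y).b + BTcl x y := by
  rw [map_add, Ext2.add_b, sec_u, sec_u]

/-- The inverse map. -/
noncomputable def psi (M L : Type*) [AddCommGroup M] [AddCommGroup L] :
    AGrp (TensorProduct ℤ M L) →+ BGrp M L :=
  QuotientAddGroup.lift (trSub (TensorProduct ℤ M L))
    (AddMonoidHom.coprod (FreeAbelianGroup.lift fun x => (sec M L x).b) (bT M L)) (by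
      unfold trSub
      rw [AddSubgroup.closure_le]
      rintro _ ⟨a, b, rfl⟩
      have h : bT M L (QuotientAddGroup.mk (a ⊗ₜ[ℤ] b)) = BTcl a b := rfl
      simp only [SetLike.mem_coe, AddMonoidHom.mem_ker, AddMonoidHom.coprod_apply, map_sub,
        map_neg, FreeAbelianGroup.lift_apply_of, sec_b_add, h]
      abel)

theorem psi_N (x : TensorProduct ℤ M L) : psi M L (Ncl x) = (sec M L x).b := by
  have : psi M L (Ncl x) =
    FreeAbelianGroup.lift (fun x => (sec M L x).b) (FreeAbelianGroup.of x) + bT M L 0 := rfl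
  rw [this, FreeAbelianGroup.lift_apply_of, map_zero, add_zero]

theorem psi_T (x y : TensorProduct ℤ M L) : psi M L (Tcl x y) = BTcl x y := by
  have : psi M L (Tcl x y) =
    FreeAbelianGroup.lift (fun x => (sec M L x).b) 0 + BTcl x y := rfl
  rw [this, map_zero, zero_add]

/-- The inclusion of the symmetric quotient in `A`. -/
noncomputable def aT (M : Type*) [AddCommGroup M] : QGrp M →+ AGrp M :=
  (QuotientAddGroup.mk' (trSub M)).comp (AddMonoidHom.inr _ _)

/-- The forward map. -/
noncomputable def phi (M L : Type*) [AddCommGroup M] [AddCommGroup L] :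
    BGrp M L →+ AGrp (TensorProduct ℤ M L) :=
  QuotientAddGroup.lift (bSub M L)
    (AddMonoidHom.coprod (FreeAbelianGroup.lift fun x : M × L => Ncl (x.1 ⊗ₜ[ℤ] x.2))
      (aT (TensorProduct ℤ M L))) (by
      unfold bSub
      rw [AddSubgroup.closure_le]
      have h : ∀ a b, aT (TensorProduct ℤ M L) (QuotientAddGroup.mk (a ⊗ₜ[ℤ] b)) = Tcl a b :=
        fun _ _ => rfl
      rintro _ (⟨a, b, l, rfl⟩ | ⟨m, y, z, rfl⟩)
      · simp only [SetLike.mem_coe, AddMonoidHom.mem_ker, AddMonoidHom.coprod_apply, map_sub,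
          map_neg, FreeAbelianGroup.lift_apply_of, TensorProduct.add_tmul, Ncl_add, h]
        abel
      · simp only [SetLike.mem_coe, AddMonoidHom.mem_ker, AddMonoidHom.coprod_apply, map_sub,
          map_neg, FreeAbelianGroup.lift_apply_of, TensorProduct.tmul_add, Ncl_add, h]
        abel)

theorem phi_P (m : M) (l : L) : phi M L (Pcl m l) = Ncl (m ⊗ₜ[ℤ] l) := by
  have : phi M L (Pcl m l) =
    FreeAbelianGroup.lift (fun x : M × L => Ncl (x.1 ⊗ₜ[ℤ] x.2)) (FreeAbelianGroup.of (m, l))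
      + aT (TensorProduct ℤ M L) 0 := rfl
  rw [this, FreeAbelianGroup.lift_apply_of, map_zero, add_zero]

theorem phi_T (x y : TensorProduct ℤ M L) : phi M L (BTcl x y) = Tcl x y := by
  have : phi M L (BTcl x y) =
    FreeAbelianGroup.lift (fun x : M × L => Ncl (x.1 ⊗ₜ[ℤ] x.2)) 0 + Tcl x y := rfl
  rw [this, map_zero, zero_add]

theorem quot_hom_ext {X V G : Type*} [AddCommGroup V] [AddCommGroup G]
    (S : AddSubgroup (FreeAbelianGroup X × QGrp V))
    (f g : (FreeAbelianGroup X × QGrp V) ⧸ S →+ G)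
    (h1 : ∀ x, f (QuotientAddGroup.mk (FreeAbelianGroup.of x, 0)) =
      g (QuotientAddGroup.mk (FreeAbelianGroup.of x, 0)))
    (h2 : ∀ u v : V, f (QuotientAddGroup.mk (0, QuotientAddGroup.mk (u ⊗ₜ[ℤ] v))) =
      g (QuotientAddGroup.mk (0, QuotientAddGroup.mk (u ⊗ₜ[ℤ] v)))) : f = g := by
  apply QuotientAddGroup.addMonoidHom_ext
  ext p
  obtain ⟨a, q⟩ := p
  have hp : ((a, q) : FreeAbelianGroup X × QGrp V) =
      AddMonoidHom.inl _ _ a + AddMonoidHom.inr _ _ q := by simp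
  have e1 : (f.comp (QuotientAddGroup.mk' S)).comp (AddMonoidHom.inl _ _) =
      (g.comp (QuotientAddGroup.mk' S)).comp (AddMonoidHom.inl _ _) :=
    FreeAbelianGroup.lift_ext _ _ h1
  have e2 : (f.comp (QuotientAddGroup.mk' S)).comp (AddMonoidHom.inr _ _) =
      (g.comp (QuotientAddGroup.mk' S)).comp (AddMonoidHom.inr _ _) := by
    apply QuotientAddGroup.addMonoidHom_ext
    ext x
    induction x using TensorProduct.induction_on with
    | zero => rw [map_zero, map_zero]
    | tmul u v => exact h2 u v
    | add x y hx hy => rw [map_add, map_add, hx, hy]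
  rw [hp, map_add, map_add]
  exact congrArg₂ (· + ·) (DFunLike.congr_fun e1 a) (DFunLike.congr_fun e2 q)

theorem BGrp_hom_ext {G : Type*} [AddCommGroup G] (f g : BGrp M L →+ G)
    (h1 : ∀ m l, f (Pcl m l) = g (Pcl m l)) (h2 : ∀ u v, f (BTcl u v) = g (BTcl u v)) : f = g :=
  quot_hom_ext _ f g (fun x => h1 x.1 x.2) h2

theorem phi_sec (x : TensorProduct ℤ M L) : phi M L (sec M L x).b = Ncl x := by
  induction x using TensorProduct.induction_on with
  | zero => rw [map_zero, Ext2.zero_b, map_zero, Ncl_zero]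
  | tmul m l => rw [sec_tmul, phi_P]
  | add x y hx hy => rw [sec_b_add, map_add, map_add, hx, hy, phi_T, Ncl_add]

theorem psi_comp_phi : (psi M L).comp (phi M L) = AddMonoidHom.id _ := by
  apply BGrp_hom_ext
  · intro m l
    rw [AddMonoidHom.comp_apply, phi_P, psi_N, sec_tmul]; rfl
  · intro u v
    rw [AddMonoidHom.comp_apply, phi_T, psi_T]; rfl

theorem phi_comp_psi : (phi M L).comp (psi M L) = AddMonoidHom.id _ := by
  apply quot_hom_ext
  · intro x
    change phi M L (psi M L (Ncl x)) = Ncl x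
    rw [psi_N, phi_sec]
  · intro u v
    change phi M L (psi M L (Tcl u v)) = Tcl u v
    rw [psi_T, phi_T]

end Helpers

/-- There is a unique group homomorphism `B(M, L) → A(M ⊗_ℤ L)` sending `[P_{(m,l)}]` to
`[N_{m ⊗ l}]` and `[u ⊗ v]` to `[u ⊗ v]`, and it is an isomorphism. -/
theorem stmt_14 (M L : Type*) [AddCommGroup M] [AddCommGroup L] :
    (∃! φ : BGrp M L →+ AGrp (TensorProduct ℤ M L),
      (∀ (m : M) (l : L), φ (Pcl m l) = Ncl (m ⊗ₜ[ℤ] l)) ∧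
      (∀ u v : TensorProduct ℤ M L, φ (BTcl u v) = Tcl u v)) ∧
    (∀ φ : BGrp M L →+ AGrp (TensorProduct ℤ M L),
      ((∀ (m : M) (l : L), φ (Pcl m l) = Ncl (m ⊗ₜ[ℤ] l)) ∧
       (∀ u v : TensorProduct ℤ M L, φ (BTcl u v) = Tcl u v)) →
      Function.Bijective φ) := by
  refine ⟨⟨phi M L, ⟨phi_P, phi_T⟩, ?_⟩, ?_⟩
  · rintro f ⟨h1, h2⟩
    apply BGrp_hom_ext
    · intro m l
      rw [h1, phi_P]
    · intro u v
      rw [h2, phi_T]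
  · rintro f ⟨h1, h2⟩
    have hf : f = phi M L := by
      apply BGrp_hom_ext
      · intro m l
        rw [h1, phi_P]
      · intro u v
        rw [h2, phi_T]
    subst hf
    exact Function.bijective_iff_has_inverse.mpr
      ⟨psi M L, fun x => DFunLike.congr_fun psi_comp_phi x,
        fun x => DFunLike.congr_fun phi_comp_psi x⟩
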